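/- Any instance with two agents and four distinct items (each item has positive value to at least one of the two agents, and no two items have identical valuation pairs (v_{1j}, v_{2j})) admits at least two distinct symEF1 partitions, where two partitions are distinct if they are not equal as (unordered) sets of bundles. -/

import Mathlib

/-- Additive value of agent `i` for bundle `A`. -/
def bundleVal {n m : ℕ} (v : Fin n → Fin m → ℝ) (i : Fin n) (A : Finset (Fin m)) : ℝ :=
  ∑ j ∈ A, v i j

/-- Value of agent `i`'s favorite item in `A` (0 if `A` is empty). -/
def maxVal {n m : ℕ} (v : Fin n → Fin m → ℝ) (i : Fin n) (A : Finset (Fin m)) : ℝ :=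
  if h : A.Nonempty then A.sup' h (v i) else 0

/-- Value of agent `i`'s least-valued item in `A` (0 if `A` is empty). -/
def minVal {n m : ℕ} (v : Fin n → Fin m → ℝ) (i : Fin n) (A : Finset (Fin m)) : ℝ :=
  if h : A.Nonempty then A.inf' h (v i) else 0

/-- `(A 1, …, A n)` is a partition of the items: every item is in exactly one bundle. -/
def IsPartition {n m : ℕ} (A : Fin n → Finset (Fin m)) : Prop :=
  ∀ j : Fin m, ∃! k : Fin n, j ∈ A k

/-- Symmetrically envy free up to one good. -/
def SymEF1 {n m : ℕ} (v : Fin n → Fin m → ℝ) (A : Fin n → Finset (Fin m)) : Prop :=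
  ∀ i k l : Fin n, bundleVal v i (A k) ≥ bundleVal v i (A l) - maxVal v i (A l)

/-- Symmetrically envy free up to any good. -/
def SymEFX {n m : ℕ} (v : Fin n → Fin m → ℝ) (A : Fin n → Finset (Fin m)) : Prop :=
  ∀ i k l : Fin n, bundleVal v i (A k) ≥ bundleVal v i (A l) - minVal v i (A l)

/-- `σ` is a ranking for agent `i`: `σ` lists the items from most to least favorite. -/
def IsRanking {n m : ℕ} (v : Fin n → Fin m → ℝ) (i : Fin n) (σ : Equiv.Perm (Fin m)) : Prop :=
  ∀ (j : ℕ) (h : j + 1 < m), v i (σ ⟨j + 1, h⟩) ≤ v i (σ ⟨j, Nat.lt_of_succ_lt h⟩)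

/-- The `t`-th indexed `n`-tuple (0-indexed `t`) for the ranking `σ`:
    the items ranked in positions `n*t, …, n*t + n - 1` (0-indexed, positions `< m`). -/
def nTuple {m : ℕ} (n : ℕ) (σ : Equiv.Perm (Fin m)) (t : ℕ) : Finset (Fin m) :=
  (Finset.univ.filter (fun p : Fin m => p.val / n = t)).image σ

/-- The `l`-th bundle (0-indexed `l`) of the round-robin allocation of the agent whose
    ranking is `σ`: the items ranked in positions congruent to `l` modulo `n`. -/
def rrBundle {m : ℕ} (n : ℕ) (σ : Equiv.Perm (Fin m)) (l : ℕ) : Finset (Fin m) :=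
  (Finset.univ.filter (fun p : Fin m => p.val % n = l)).image σ

/-- The partition `A` separates the indexed `n`-tuples induced by the ranking `σ`:
    no two distinct items of a common `n`-tuple lie in the same bundle. -/
def Separates {n m : ℕ} (σ : Equiv.Perm (Fin m)) (A : Fin n → Finset (Fin m)) : Prop :=
  ∀ (t : ℕ), ∀ j1 ∈ nTuple n σ t, ∀ j2 ∈ nTuple n σ t, j1 ≠ j2 →
    ∀ k : Fin n, j1 ∈ A k → j2 ∉ A k

/-- The item graph: vertices are the items, with an edge between two distinct items
    whenever they belong to a common indexed `n`-tuple of some agent. -/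
def itemGraph {m : ℕ} (n : ℕ) (σ : Fin n → Equiv.Perm (Fin m)) : SimpleGraph (Fin m) :=
  SimpleGraph.fromRel (fun j1 j2 => ∃ (i : Fin n) (t : ℕ),
    j1 ∈ nTuple n (σ i) t ∧ j2 ∈ nTuple n (σ i) t)

/-- A valuation of two pairs `{a, b}` and `{c, d}` that is envy free up to one good. -/
def PairsFair (a b c d : ℝ) : Prop :=
  (a ≤ c + d ∨ b ≤ c + d) ∧ (c ≤ a + b ∨ d ≤ a + b)

/-- A valuation of `{a}` and `{b, c, d}` that is envy free up to one good. -/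
def SingletonFair (a b c d : ℝ) : Prop :=
  b + c ≤ a ∨ b + d ≤ a ∨ c + d ≤ a

/-- If one pairing of four goods is unfair, the other two pairings are fair, and so is
separating either good of the more valuable pair from the rest. -/
lemma fair_of_not_pairsFair {a b c d : ℝ} (ha : 0 ≤ a) (hb : 0 ≤ b) (hc : 0 ≤ c) (hd : 0 ≤ d)
    (h : ¬ PairsFair a b c d) :
    PairsFair a c b d ∧ PairsFair a d b c ∧
      ((SingletonFair a b c d ∧ SingletonFair b a c d) ∨
        (SingletonFair c a b d ∧ SingletonFair d a b c)) := by
  unfold PairsFair SingletonFair at *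
  grind

lemma le_maxVal {n m : ℕ} (v : Fin n → Fin m → ℝ) (i : Fin n) {A : Finset (Fin m)} {j : Fin m}
    (hj : j ∈ A) : v i j ≤ maxVal v i A := by
  rw [maxVal, dif_pos ⟨j, hj⟩]
  exact Finset.le_sup' (v i) hj

lemma isPartition_compl {m : ℕ} (S : Finset (Fin m)) : IsPartition ![S, Sᶜ] := by
  intro j
  by_cases hj : j ∈ S
  · exact ⟨0, by simpa using hj, by simp [Fin.forall_fin_two, hj]⟩
  · exact ⟨1, by simpa using hj, by simp [Fin.forall_fin_two, hj]⟩

/-- A two-bundle partition is symEF1 as soon as every agent can erase some good from either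
bundle to remove the envy towards it. -/
lemma symEF1_compl {m : ℕ} {v : Fin 2 → Fin m → ℝ} (hv : ∀ i j, 0 ≤ v i j) {S : Finset (Fin m)}
    (h : ∀ i, (∃ j ∈ S, ∑ k ∈ S, v i k - v i j ≤ ∑ k ∈ Sᶜ, v i k) ∧
      ∃ j ∈ Sᶜ, ∑ k ∈ Sᶜ, v i k - v i j ≤ ∑ k ∈ S, v i k) :
    SymEF1 v ![S, Sᶜ] := by
  intro i
  obtain ⟨⟨x, hx, hxS⟩, y, hy, hyS⟩ := h i
  have hx' := le_maxVal v i hx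
  have hy' := le_maxVal v i hy
  have hx0 := hv i x
  have hy0 := hv i y
  simp only [Fin.forall_fin_two, bundleVal, Matrix.cons_val_zero, Matrix.cons_val_one]
  refine ⟨⟨?_, ?_⟩, ?_, ?_⟩ <;> linarith

/-- Splitting four goods into two pairs that are fair for both agents is symEF1. -/
lemma symEF1_pair {v : Fin 2 → Fin 4 → ℝ} (hv : ∀ i j, 0 ≤ v i j) {a b c d : Fin 4}
    (hab : a ≠ b) (hcd : c ≠ d) (hS : ({a, b} : Finset (Fin 4))ᶜ = {c, d})
    (h : ∀ i, PairsFair (v i a) (v i b) (v i c) (v i d)) :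
    SymEF1 v ![{a, b}, {a, b}ᶜ] := by
  refine symEF1_compl hv fun i => ?_
  rw [hS, Finset.sum_pair hab, Finset.sum_pair hcd]
  have hi := h i
  simp only [PairsFair, Finset.mem_insert, Finset.mem_singleton, exists_eq_or_imp,
    exists_eq_left] at hi ⊢
  grind

/-- Separating one good from three others, fairly for both agents, is symEF1. -/
lemma symEF1_singleton {v : Fin 2 → Fin 4 → ℝ} (hv : ∀ i j, 0 ≤ v i j) {a b c d : Fin 4}
    (hbc : b ≠ c) (hbd : b ≠ d) (hcd : c ≠ d) (hS : ({a} : Finset (Fin 4))ᶜ = {b, c, d})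
    (h : ∀ i, SingletonFair (v i a) (v i b) (v i c) (v i d)) :
    SymEF1 v ![{a}, {a}ᶜ] := by
  refine symEF1_compl hv fun i => ?_
  rw [hS, Finset.sum_singleton, Finset.sum_insert (by simp [hbc, hbd]), Finset.sum_pair hcd]
  have hi := h i
  have hb := hv i b
  have hc := hv i c
  have hd := hv i d
  simp only [SingletonFair, Finset.mem_insert, Finset.mem_singleton, exists_eq_or_imp,
    exists_eq_left] at hi ⊢
  grind

/-- any instance with two agents and four distinct items admits at least
two distinct symEF1 partitions (distinct as unordered collections of bundles). -/
theorem statement12 (v : Fin 2 → Fin 4 → ℝ)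
    (hv : ∀ i j, 0 ≤ v i j ∧ v i j ≤ 1)
    (hpos : ∀ j : Fin 4, ∃ i : Fin 2, 0 < v i j)
    (hdistinct : ∀ j1 j2 : Fin 4, (∀ i : Fin 2, v i j1 = v i j2) → j1 = j2) :
    ∃ A B : Fin 2 → Finset (Fin 4),
      IsPartition A ∧ SymEF1 v A ∧ IsPartition B ∧ SymEF1 v B ∧
      Finset.univ.val.map A ≠ Finset.univ.val.map B := by
  have h0 : ∀ i j, 0 ≤ v i j := fun i j => (hv i j).1
  have two_splits {S T : Finset (Fin 4)} (hS : SymEF1 v ![S, Sᶜ]) (hT : SymEF1 v ![T, Tᶜ])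
      (hST : Finset.univ.val.map ![S, Sᶜ] ≠ Finset.univ.val.map ![T, Tᶜ]) :
      ∃ A B : Fin 2 → Finset (Fin 4),
        IsPartition A ∧ SymEF1 v A ∧ IsPartition B ∧ SymEF1 v B ∧
        Finset.univ.val.map A ≠ Finset.univ.val.map B :=
    ⟨_, _, isPartition_compl S, hS, isPartition_compl T, hT, hST⟩
  have p1 := symEF1_pair h0 (a := 0) (b := 1) (c := 2) (d := 3) (by decide) (by decide) (by decide)
  have p2 := symEF1_pair h0 (a := 0) (b := 2) (c := 1) (d := 3) (by decide) (by decide) (by decide)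
  have p3 := symEF1_pair h0 (a := 0) (b := 3) (c := 1) (d := 2) (by decide) (by decide) (by decide)
  have s0 := symEF1_singleton h0 (a := 0) (b := 1) (c := 2) (d := 3)
    (by decide) (by decide) (by decide) (by decide)
  have s1 := symEF1_singleton h0 (a := 1) (b := 0) (c := 2) (d := 3)
    (by decide) (by decide) (by decide) (by decide)
  have s2 := symEF1_singleton h0 (a := 2) (b := 0) (c := 1) (d := 3)
    (by decide) (by decide) (by decide) (by decide)
  have s3 := symEF1_singleton h0 (a := 3) (b := 0) (c := 1) (d := 2)
    (by decide) (by decide) (by decide) (by decide)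
  by_contra hno
  have n12 := fun hS hT => hno (two_splits (S := {0, 1}) (T := {0, 2}) hS hT (by decide))
  have n13 := fun hS hT => hno (two_splits (S := {0, 1}) (T := {0, 3}) hS hT (by decide))
  have n23 := fun hS hT => hno (two_splits (S := {0, 2}) (T := {0, 3}) hS hT (by decide))
  have ns (S : Finset (Fin 4)) (hS : S ∈ ({{0, 1}, {0, 2}, {0, 3}} : Finset (Finset (Fin 4))))
      (j : Fin 4) (hE : SymEF1 v ![S, Sᶜ]) : ¬ SymEF1 v ![{j}, {j}ᶜ] := fun hj =>
    hno (two_splits hE hj (by clear hE hj; revert S j; decide))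
  have unfair1 i := fair_of_not_pairsFair (h0 i 0) (h0 i 1) (h0 i 2) (h0 i 3)
  have unfair2 i := fair_of_not_pairsFair (h0 i 0) (h0 i 2) (h0 i 1) (h0 i 3)
  have unfair3 i := fair_of_not_pairsFair (h0 i 0) (h0 i 3) (h0 i 1) (h0 i 2)
  have pair_comm (a b c d : ℝ) : PairsFair a b c d ↔ PairsFair a b d c := by
    unfold PairsFair
    grind
  have single_swap (a b c d : ℝ) : SingletonFair a b c d ↔ SingletonFair a c b d := by
    unfold SingletonFair
    grind
  have single_rotate (a b c d : ℝ) : SingletonFair a b c d ↔ SingletonFair a c d b := by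
    unfold SingletonFair
    grind
  have m1 := ns {0, 1} (by decide)
  have m2 := ns {0, 2} (by decide)
  have m3 := ns {0, 3} (by decide)
  simp only [Fin.forall_fin_two] at p1 p2 p3 s0 s1 s2 s3 unfair1 unfair2 unfair3
  clear ns hno
  grind
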